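/- Quantitative Brezis–Lieb inequality, low exponent: for every p ∈ [1,2) there is a constant C_p < ∞ such that for all (scalar- or vector-valued) measurable functions f, g on 𝕋^d one has | ‖f+g‖_{L^p}^p − ‖f‖_{L^p}^p − ‖g‖_{L^p}^p | ≤ C_p ( ‖f‖_{L^{1/(2−p)}} ‖g‖_{L^1}^{p−1} + ‖f‖_{L^∞}^{p−1} ‖g‖_{L^1} ). -/

import Mathlib

open MeasureTheory ENNReal
open scoped NNReal

universe u v

/-- Upper half of the pointwise estimate, with exponent `1 + q`. -/
theorem ENNReal.rpow_one_add_le_of_le_add {x y z : ℝ≥0∞} {q : ℝ} (hq0 : 0 ≤ q) (hq1 : q ≤ 1)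
    (hz : z ≤ x + y) :
    z ^ (1 + q) ≤ x ^ (1 + q) + y ^ (1 + q) + (x * y ^ q + x ^ q * y) := by
  calc z ^ (1 + q) ≤ (x + y) ^ (1 + q) := ENNReal.rpow_le_rpow hz (by linarith)
    _ = (x + y) * (x + y) ^ q := by
      rw [ENNReal.rpow_add_of_nonneg _ _ zero_le_one hq0, ENNReal.rpow_one]
    _ ≤ (x + y) * (x ^ q + y ^ q) := by
      gcongr
      exact ENNReal.rpow_add_le_add_rpow _ _ hq0 hq1
    _ = x ^ (1 + q) + y ^ (1 + q) + (x * y ^ q + x ^ q * y) := by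
      simp only [ENNReal.rpow_add_of_nonneg _ _ zero_le_one hq0, ENNReal.rpow_one]
      ring

/-- Lower half of the pointwise estimate for the three sides of a triangle, with exponent `1 + q`,
when the second side is the smaller one. -/
theorem ENNReal.add_rpow_one_add_le_of_triangle_of_le {x y z : ℝ≥0∞} {q : ℝ} (hq0 : 0 ≤ q)
    (hq1 : q ≤ 1) (hx : x ≤ z + y) (hz : z ≤ x + y) (hyx : y ≤ x) :
    x ^ (1 + q) + y ^ (1 + q) ≤ z ^ (1 + q) + 3 * (x * y ^ q + x ^ q * y) := by
  simp only [ENNReal.rpow_add_of_nonneg _ _ zero_le_one hq0, ENNReal.rpow_one]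
  have hxq : x ^ q ≤ z ^ q + y ^ q :=
    (ENNReal.rpow_le_rpow hx hq0).trans (ENNReal.rpow_add_le_add_rpow _ _ hq0 hq1)
  have hyy : y * y ^ q ≤ x ^ q * y := by
    rw [mul_comm]
    gcongr
  calc x * x ^ q + y * y ^ q
      ≤ (z + y) * x ^ q + x ^ q * y := by gcongr
    _ = z * x ^ q + 2 * (x ^ q * y) := by ring
    _ ≤ z * (z ^ q + y ^ q) + 2 * (x ^ q * y) := by gcongr
    _ = z * z ^ q + z * y ^ q + 2 * (x ^ q * y) := by ring
    _ ≤ z * z ^ q + (x + y) * y ^ q + 2 * (x ^ q * y) := by gcongr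
    _ = z * z ^ q + x * y ^ q + y * y ^ q + 2 * (x ^ q * y) := by ring
    _ ≤ z * z ^ q + x * y ^ q + x ^ q * y + 2 * (x ^ q * y) := by gcongr
    _ = z * z ^ q + (1 * (x * y ^ q) + 3 * (x ^ q * y)) := by ring
    _ ≤ z * z ^ q + (3 * (x * y ^ q) + 3 * (x ^ q * y)) := by
      gcongr
      norm_num
    _ = z * z ^ q + 3 * (x * y ^ q + x ^ q * y) := by ring

/-- Lower half of the pointwise estimate for the three sides of a triangle, with exponent
`1 + q`. -/
theorem ENNReal.add_rpow_one_add_le_of_triangle {x y z : ℝ≥0∞} {q : ℝ} (hq0 : 0 ≤ q)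
    (hq1 : q ≤ 1) (hx : x ≤ z + y) (hy : y ≤ z + x) (hz : z ≤ x + y) :
    x ^ (1 + q) + y ^ (1 + q) ≤ z ^ (1 + q) + 3 * (x * y ^ q + x ^ q * y) := by
  rcases le_total y x with h | h
  · exact add_rpow_one_add_le_of_triangle_of_le hq0 hq1 hx hz h
  · have := add_rpow_one_add_le_of_triangle_of_le hq0 hq1 hy (hz.trans_eq (add_comm x y)) h
    rwa [add_comm (y ^ _), add_comm (y * _), mul_comm (y ^ q) x, mul_comm y (x ^ q)] at this

/-- An instance of Hölder's inequality with exponents `1 / (1 - q)` and `1 / q`, including the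
endpoint `q = 0`. -/
theorem MeasureTheory.lintegral_enorm_mul_enorm_rpow_le {α E F : Type*} [MeasurableSpace α]
    {μ : Measure α} [NormedAddCommGroup E] [NormedAddCommGroup F] {f : α → E} {g : α → F}
    (hf : AEStronglyMeasurable f μ) (hg : AEStronglyMeasurable g μ) {q : ℝ} (hq0 : 0 ≤ q)
    (hq1 : q < 1) :
    ∫⁻ a, ‖f a‖ₑ * ‖g a‖ₑ ^ q ∂μ
      ≤ eLpNorm f (ENNReal.ofReal (1 / (1 - q))) μ * eLpNorm g 1 μ ^ q := by
  have h : 0 < 1 - q := by linarith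
  have hr : 0 < 1 / (1 - q) := by positivity
  rw [eLpNorm_eq_lintegral_rpow_enorm_toReal (by simpa using hr) ofReal_ne_top,
    eLpNorm_one_eq_lintegral_enorm, ENNReal.toReal_ofReal hr.le, one_div_one_div]
  have key := ENNReal.lintegral_mul_norm_pow_le (hf.enorm.pow_const (1 / (1 - q))) hg.enorm h.le
    hq0 (by ring)
  simpa only [← ENNReal.rpow_mul, one_div_mul_cancel h.ne', ENNReal.rpow_one] using key

/-- An instance of Hölder's inequality with exponents `∞` and `1`. -/
theorem MeasureTheory.lintegral_enorm_rpow_mul_enorm_le {α E F : Type*} [MeasurableSpace α]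
    {μ : Measure α} [NormedAddCommGroup E] [NormedAddCommGroup F] (f : α → E) {g : α → F}
    (hg : AEStronglyMeasurable g μ) {q : ℝ} (hq0 : 0 ≤ q) :
    ∫⁻ a, ‖f a‖ₑ ^ q * ‖g a‖ₑ ∂μ ≤ eLpNorm f ⊤ μ ^ q * eLpNorm g 1 μ := by
  rw [eLpNorm_one_eq_lintegral_enorm, ← lintegral_const_mul'' _ hg.enorm, eLpNorm_exponent_top]
  refine lintegral_mono_ae ?_
  filter_upwards [ae_le_eLpNormEssSup (f := f) (μ := μ)] with a ha
  gcongr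

/-- The `p`-th power of the `L^p` norm as a lower integral. -/
theorem MeasureTheory.eLpNorm_ofReal_rpow_eq_lintegral {α E : Type*} [MeasurableSpace α]
    {μ : Measure α} [NormedAddCommGroup E] (f : α → E) {p : ℝ} (hp : 0 < p) :
    eLpNorm f (ENNReal.ofReal p) μ ^ p = ∫⁻ a, ‖f a‖ₑ ^ p ∂μ := by
  rw [eLpNorm_eq_lintegral_rpow_enorm_toReal (by simpa using hp) ofReal_ne_top,
    ENNReal.toReal_ofReal hp.le, ← ENNReal.rpow_mul, one_div_mul_cancel hp.ne', ENNReal.rpow_one]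

/-- Quantitative Brezis-Lieb inequality, low exponent
`p ∈ [1,2)`: there is a constant `C_p < ∞`, depending only on `p`, such that
`| ‖f+g‖_{L^p}^p − ‖f‖_{L^p}^p − ‖g‖_{L^p}^p |
   ≤ C_p ( ‖f‖_{L^{1/(2−p)}} ‖g‖_{L^1}^{p−1} + ‖f‖_{L^∞}^{p−1} ‖g‖_{L^1} )`
for all measurable functions on any measure space.  The inequality is stated in
`ℝ≥0∞` as the equivalent pair of one-sided estimates, so that it also covers the
(trivially true) cases where some of the quantities involved are infinite. -/
theorem quantitative_brezis_lieb_low (p : ℝ) (hp1 : 1 ≤ p) (hp2 : p < 2) :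
    ∃ C : ℝ≥0,
      ∀ (α : Type u) [MeasurableSpace α] (μ : Measure α)
        (E : Type v) [NormedAddCommGroup E] (f g : α → E),
        AEStronglyMeasurable f μ → AEStronglyMeasurable g μ →
        (eLpNorm (f + g) (ENNReal.ofReal p) μ ^ p
            ≤ eLpNorm f (ENNReal.ofReal p) μ ^ p + eLpNorm g (ENNReal.ofReal p) μ ^ p
              + (C : ℝ≥0∞) * (eLpNorm f (ENNReal.ofReal (1/(2-p))) μ
                    * eLpNorm g 1 μ ^ (p-1)
                  + eLpNorm f ⊤ μ ^ (p-1) * eLpNorm g 1 μ))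
        ∧ (eLpNorm f (ENNReal.ofReal p) μ ^ p + eLpNorm g (ENNReal.ofReal p) μ ^ p
            ≤ eLpNorm (f + g) (ENNReal.ofReal p) μ ^ p
              + (C : ℝ≥0∞) * (eLpNorm f (ENNReal.ofReal (1/(2-p))) μ
                    * eLpNorm g 1 μ ^ (p-1)
                  + eLpNorm f ⊤ μ ^ (p-1) * eLpNorm g 1 μ)) := by
  obtain ⟨q, rfl⟩ : ∃ q, p = 1 + q := ⟨p - 1, by ring⟩
  have hq0 : 0 ≤ q := by linarith
  have hq1 : q < 1 := by linarith
  refine ⟨3, fun α _ μ E _ f g hf hg => ?_⟩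
  have hp : 0 < 1 + q := by linarith
  rw [add_sub_cancel_left, show (2 : ℝ) - (1 + q) = 1 - q by ring]
  simp only [eLpNorm_ofReal_rpow_eq_lintegral _ hp]
  have hfp : AEMeasurable (fun a => ‖f a‖ₑ ^ (1 + q)) μ := hf.enorm.pow_const _
  have hsum : AEMeasurable (fun a => ‖f a‖ₑ ^ (1 + q) + ‖g a‖ₑ ^ (1 + q)) μ :=
    hfp.add (hg.enorm.pow_const _)
  have hfgp : AEMeasurable (fun a => ‖(f + g) a‖ₑ ^ (1 + q)) μ := (hf.add hg).enorm.pow_const _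
  have hfg : AEMeasurable (fun a => ‖f a‖ₑ * ‖g a‖ₑ ^ q) μ := hf.enorm.mul (hg.enorm.pow_const _)
  have hcross : ∫⁻ a, (‖f a‖ₑ * ‖g a‖ₑ ^ q + ‖f a‖ₑ ^ q * ‖g a‖ₑ) ∂μ
      ≤ eLpNorm f (ENNReal.ofReal (1 / (1 - q))) μ * eLpNorm g 1 μ ^ q
        + eLpNorm f ⊤ μ ^ q * eLpNorm g 1 μ := by
    rw [lintegral_add_left' hfg]
    exact add_le_add (lintegral_enorm_mul_enorm_rpow_le hf hg hq0 hq1)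
      (lintegral_enorm_rpow_mul_enorm_le f hg hq0)
  rw [ENNReal.coe_ofNat]
  constructor
  · refine le_trans ?_ (add_le_add_right (mul_le_mul_right hcross 3) _)
    rw [← lintegral_add_left' hfp, ← lintegral_const_mul' _ _ (by simp),
      ← lintegral_add_left' hsum]
    refine lintegral_mono fun a => ?_
    refine (ENNReal.rpow_one_add_le_of_le_add hq0 hq1.le (enorm_add_le (f a) (g a))).trans ?_
    gcongr
    exact le_mul_of_one_le_left' (by norm_num)
  · refine le_trans ?_ (add_le_add_right (mul_le_mul_right hcross 3) _)
    rw [← lintegral_add_left' hfp, ← lintegral_const_mul' _ _ (by simp),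
      ← lintegral_add_left' hfgp]
    refine lintegral_mono fun a => ?_
    refine ENNReal.add_rpow_one_add_le_of_triangle hq0 hq1.le ?_ ?_ (enorm_add_le (f a) (g a))
    · simpa using enorm_sub_le (a := f a + g a) (b := g a)
    · simpa using enorm_sub_le (a := f a + g a) (b := f a)
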